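/- Let d = 2 and let β > 12 be a real number, and let L be the language of the 2-ary β-free shift X^2_β with topological entropy h. Then for every n ≥ 1, e^{nh} ≤ #L_n ≤ 2.892 · e^{(n+2)h}. -/

import Mathlib

open MeasureTheory Filter Real Set

/-- The left shift on bi-infinite sequences. -/
def shift {A : Type*} (x : ℤ → A) : ℤ → A := fun n => x (n + 1)

/-- `w` occurs as a factor (finite subword) of the bi-infinite sequence `x`. -/
def FactorOf {A : Type*} (w : List A) (x : ℤ → A) : Prop :=
  ∃ i : ℤ, ∀ t : ℕ, (ht : t < w.length) → x (i + t) = w[t]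

/-- `ℓ` is a period of the word `w`. -/
def HasPeriodN {A : Type*} (w : List A) (ℓ : ℕ) : Prop :=
  1 ≤ ℓ ∧ ℓ ≤ w.length ∧ ∀ t : ℕ, (ht : t + ℓ < w.length) →
    w[t]'(lt_of_le_of_lt (Nat.le_add_right t ℓ) ht) = w[t + ℓ]

/-- The `d`-ary `β`-free shift. -/
def betaFree (d : ℕ) (β : ℝ) : Set (ℤ → Fin d) :=
  {x | ∀ w : List (Fin d), FactorOf w x → ∀ ℓ : ℕ, HasPeriodN w ℓ → (w.length : ℝ) < β * ℓ}

/-- The language of a shift space. -/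
def language {A : Type*} (X : Set (ℤ → A)) : Set (List A) :=
  {w | ∃ x ∈ X, FactorOf w x}

/-- The words of length `n` in the language of `X`. -/
def langN {A : Type*} (X : Set (ℤ → A)) (n : ℕ) : Set (List A) :=
  {w | w ∈ language X ∧ w.length = n}

/-- The cylinder of a word. -/
def cylinder {A : Type*} (w : List A) : Set (ℤ → A) :=
  {x | ∀ t : ℕ, (ht : t < w.length) → x (t : ℤ) = w[t]}

/-- A shift space: closed and shift-invariant. -/
def IsShiftSpace {A : Type*} [TopologicalSpace A] (X : Set (ℤ → A)) : Prop :=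
  IsClosed X ∧ shift '' X = X

/-- Invariance of a measure under the shift. -/
def IsShiftInvariant {A : Type*} [MeasurableSpace A] (μ : Measure (ℤ → A)) : Prop :=
  ∀ E : Set (ℤ → A), MeasurableSet E → μ (shift ⁻¹' E) = μ E

/-- The `n`-th partition sum `H_n(μ) = Σ_w −μ[w] log μ[w]`. -/
noncomputable def cylEntropySum {A : Type*} [Fintype A] [MeasurableSpace A]
    (μ : Measure (ℤ → A)) (n : ℕ) : ℝ :=
  ∑ w : Fin n → A, Real.negMulLog (μ (cylinder (List.ofFn w))).toReal

/-- `μ` is a measure of maximal entropy on `X` (with topological entropy `h`). -/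
def IsMME {A : Type*} [Fintype A] [MeasurableSpace A]
    (X : Set (ℤ → A)) (h : ℝ) (μ : Measure (ℤ → A)) : Prop :=
  IsProbabilityMeasure μ ∧ μ X = 1 ∧ IsShiftInvariant μ ∧
    Tendsto (fun n : ℕ => cylEntropySum μ n / n) atTop (nhds h)

/-- A word is a 4-power. -/
def IsFourPower {A : Type*} (s : List A) : Prop :=
  ∃ v : List A, v ≠ [] ∧ s = v ++ v ++ v ++ v

/-- Good words: words of the language no prefix or suffix of which is a 4-power. -/
def goodWords {A : Type*} (X : Set (ℤ → A)) : Set (List A) :=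
  {w | w ∈ language X ∧ (∀ p : List A, p <+: w → ¬ IsFourPower p) ∧
       (∀ s : List A, s <:+ w → ¬ IsFourPower s)}

/-- Words of the language that are concatenations of 4-powers of words of the language. -/
def fourPowerConcat {A : Type*} (X : Set (ℤ → A)) : Set (List A) :=
  {w | w ∈ language X ∧ ∃ ps : List (List A),
      (∀ p ∈ ps, ∃ v ∈ language X, v ≠ [] ∧ p = v ++ v ++ v ++ v) ∧ w = ps.flatten}

/-- Alternating concatenation `w₁u₁w₂u₂⋯`. -/
def alternate {A : Type*} : List (List A) → List (List A) → List A
  | [], _ => []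
  | w :: _, [] => w
  | w :: ws, u :: us => w ++ u ++ alternate ws us

/-- The map deleting the first `i` and the last `k` symbols of a word. -/
def phi {A : Type*} (i k : ℕ) (w : List A) : List A := (w.drop i).take (w.length - i - k)

/-- Maximal `k` such that the first `k` symbols of `w` follow the periodic
pattern of period `ℓ` determined by the prefix of `w` of length `ℓ`. -/
noncomputable def preK {A : Type*} (w : List A) (ℓ : ℕ) : ℕ :=
  sSup {k | k ≤ w.length ∧ ∀ t < k, w[t]? = w[t % ℓ]?}

/-- `pre_ℓ(w)`: the number of times the length-`ℓ` prefix of `w` repeats at the start of `w`. -/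
noncomputable def pre {A : Type*} (w : List A) (ℓ : ℕ) : ℝ := (preK w ℓ : ℝ) / ℓ

/-- `suf_ℓ(w)`: the number of times the length-`ℓ` suffix of `w` repeats at the end of `w`. -/
noncomputable def suf {A : Type*} (w : List A) (ℓ : ℕ) : ℝ := pre w.reverse ℓ

/-- Finite words none of whose factors `w[i], …, w[j-1]` has a period `ℓ` with `j - i ≥ βℓ`. -/
def IsFreeWord {A : Type*} (β : ℝ) (w : List A) : Prop :=
  ∀ i j ℓ : ℕ, 1 ≤ ℓ → i + ℓ ≤ j → j ≤ w.length →
    (∀ t, i ≤ t → t + ℓ < j → w[t]? = w[t + ℓ]?) → (j : ℝ) < i + β * ℓ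

section FreeWord

variable {A : Type*} {β : ℝ} {u v w : List A}

lemma IsFreeWord.left_of_append (h : IsFreeWord β (u ++ v)) : IsFreeWord β u := by
  intro i j ℓ hℓ hij hj hp
  refine h i j ℓ hℓ hij (by rw [List.length_append]; omega) fun t ht htj => ?_
  rw [List.getElem?_append_left (by omega), List.getElem?_append_left (by omega)]
  exact hp t ht htj

lemma IsFreeWord.right_of_append (h : IsFreeWord β (u ++ v)) : IsFreeWord β v := by
  intro i j ℓ hℓ hij hj hp
  have := h (u.length + i) (u.length + j) ℓ hℓ (by omega) (by rw [List.length_append]; omega)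
    fun t ht htj => by
      rw [List.getElem?_append_right (by omega), List.getElem?_append_right (by omega),
        hp (t - u.length) (by omega) (by omega)]
      congr 1; omega
  push_cast at this
  linarith

/-- If two free words have a non-free concatenation, the first one ends or the second one begins
with a sixth power. -/
lemma exists_sixth_power_of_not_isFreeWord_append (hβ : 12 < β) (hu : IsFreeWord β u)
    (hv : IsFreeWord β v) (huv : ¬ IsFreeWord β (u ++ v)) :
    (∃ ℓ, 1 ≤ ℓ ∧ 6 * ℓ ≤ u.length ∧
      ∀ t, u.length - 6 * ℓ ≤ t → t + ℓ < u.length → u[t]? = u[t + ℓ]?) ∨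
    (∃ ℓ, 1 ≤ ℓ ∧ 6 * ℓ ≤ v.length ∧ ∀ t, t + ℓ < 6 * ℓ → v[t]? = v[t + ℓ]?) := by
  simp only [IsFreeWord, not_forall, not_lt] at huv
  obtain ⟨i, j, ℓ, hℓ, hij, hj, hp, hlen⟩ := huv
  rw [List.length_append] at hj
  have hpos : (1 : ℝ) ≤ ℓ := by exact_mod_cast hℓ
  have h12 : i + 12 * ℓ ≤ j := by
    have : ((i + 12 * ℓ : ℕ) : ℝ) ≤ j := by push_cast; nlinarith
    exact_mod_cast this
  have hL : ∀ t, i ≤ t → t + ℓ < j → t + ℓ < u.length → u[t]? = u[t + ℓ]? := fun t h1 h2 h3 => by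
    have := hp t h1 h2
    rwa [List.getElem?_append_left (by omega), List.getElem?_append_left (by omega)] at this
  have hR : ∀ t, i ≤ u.length + t → u.length + t + ℓ < j → v[t]? = v[t + ℓ]? :=
    fun t h1 h2 => by
      have := hp _ h1 h2
      rwa [List.getElem?_append_right (by omega), List.getElem?_append_right (by omega),
        show u.length + t - u.length = t by omega,
        show u.length + t + ℓ - u.length = t + ℓ by omega] at this
  have hju : u.length < j := by
    by_contra! hc
    exact absurd (hu i j ℓ hℓ hij hc fun t h1 h2 => hL t h1 h2 (by omega)) (not_lt.2 hlen)
  have hiu : i < u.length := by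
    by_contra! hc
    have := hv (i - u.length) (j - u.length) ℓ hℓ (by omega) (by omega)
      fun t h1 h2 => hR t (by omega) (by omega)
    rw [Nat.cast_sub hc, Nat.cast_sub hju.le] at this
    linarith
  rcases le_or_gt (i + 6 * ℓ) u.length with h6 | h6
  · exact .inl ⟨ℓ, hℓ, by omega, fun t h1 h2 => hL t (by omega) (by omega) h2⟩
  · exact .inr ⟨ℓ, hℓ, by omega, fun t h1 => hR t (by omega) (by omega)⟩

lemma eq_of_take_eq_of_period {n k ℓ : ℕ} (hℓ : 1 ≤ ℓ) (hk : k + ℓ ≤ n)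
    (hu : u.length = n) (hv : v.length = n)
    (pu : ∀ t, n - (k + ℓ) ≤ t → t + ℓ < n → u[t]? = u[t + ℓ]?)
    (pv : ∀ t, n - (k + ℓ) ≤ t → t + ℓ < n → v[t]? = v[t + ℓ]?)
    (h : u.take (n - k) = v.take (n - k)) : u = v := by
  refine List.ext_getElem? fun t => ?_
  induction t using Nat.strong_induction_on with
  | _ t ih =>
    rcases lt_or_ge t (n - k) with h1 | h1
    · rw [← List.getElem?_take_of_lt h1, h, List.getElem?_take_of_lt h1]
    · rcases lt_or_ge t n with h2 | h2
      · have e := ih (t - ℓ) (by omega)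
        rwa [pu (t - ℓ) (by omega) (by omega), pv (t - ℓ) (by omega) (by omega),
          Nat.sub_add_cancel (by omega)] at e
      · rw [List.getElem?_eq_none (by omega), List.getElem?_eq_none (by omega)]

lemma eq_of_drop_eq_of_period {n k ℓ : ℕ} (hℓ : 1 ≤ ℓ)
    (pu : ∀ t, t + ℓ < k + ℓ → u[t]? = u[t + ℓ]?) (hu : u.length = n)
    (pv : ∀ t, t + ℓ < k + ℓ → v[t]? = v[t + ℓ]?) (hv : v.length = n)
    (h : u.drop k = v.drop k) : u = v := by
  have key : ∀ m t, n - t = m → u[t]? = v[t]? := by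
    intro m
    induction m using Nat.strong_induction_on with
    | _ m ih =>
      intro t ht
      rcases lt_or_ge t n with h2 | h2
      · rcases lt_or_ge t k with h1 | h1
        · rw [pu t (by omega), pv t (by omega)]
          exact ih _ (by omega) (t + ℓ) rfl
        · have e := congrArg (fun l => l[t - k]?) h
          simpa [List.getElem?_drop, Nat.add_sub_cancel' h1] using e
      · rw [List.getElem?_eq_none (by omega), List.getElem?_eq_none (by omega)]
  exact List.ext_getElem? fun t => key _ t rfl

lemma isFreeWord_of_mem_language {d : ℕ} {w : List (Fin d)} (h : w ∈ language (betaFree d β)) :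
    IsFreeWord β w := by
  obtain ⟨x, hx, a, ha⟩ := h
  intro i j ℓ hℓ hij hj hp
  have hlen : ((w.drop i).take (j - i)).length = j - i := by
    rw [List.length_take, List.length_drop]; omega
  have := hx ((w.drop i).take (j - i)) ⟨a + i, fun t ht => ?_⟩ ℓ ⟨hℓ, by omega, fun t ht => ?_⟩
  · rw [hlen, Nat.cast_sub (by omega)] at this
    linarith
  · rw [hlen] at ht
    rw [List.getElem_take, List.getElem_drop, ← ha (i + t) (by omega)]
    push_cast; ring_nf
  · rw [hlen] at ht
    have e := hp (i + t) (by omega) (by omega)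
    rw [List.getElem?_eq_getElem (by omega), List.getElem?_eq_getElem (by omega),
      Option.some_inj] at e
    simp only [List.getElem_take, List.getElem_drop, e, add_assoc]

/-- `v` extends to a free word by `k` letters on both sides. -/
def IsExtendable (β : ℝ) (k : ℕ) (v : List A) : Prop :=
  ∃ p q : List A, p.length = k ∧ q.length = k ∧ IsFreeWord β (p ++ v ++ q)

lemma IsExtendable.mono {k m : ℕ} (hkm : k ≤ m) (h : IsExtendable β m v) :
    IsExtendable β k v := by
  obtain ⟨p, q, hp, hq, hf⟩ := h
  refine ⟨p.drop (m - k), q.take k, by simp; omega, by simp; omega, ?_⟩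
  rw [← List.take_append_drop (m - k) p, ← List.take_append_drop k q] at hf
  refine IsFreeWord.left_of_append (v := q.drop k)
    (IsFreeWord.right_of_append (u := p.take (m - k)) ?_)
  simpa only [List.append_assoc] using hf

lemma IsExtendable.left_of_append {k : ℕ} (h : IsExtendable β k (u ++ v)) :
    IsExtendable β k u := by
  obtain ⟨p, q, hp, hq, hf⟩ := h
  refine ⟨p, (v ++ q).take k, hp, by simp; omega,
    IsFreeWord.left_of_append (v := (v ++ q).drop k) ?_⟩
  simpa only [List.append_assoc, List.take_append_drop] using hf

lemma IsExtendable.right_of_append {k : ℕ} (h : IsExtendable β k (u ++ v)) :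
    IsExtendable β k v := by
  obtain ⟨p, q, hp, hq, hf⟩ := h
  have hlen : (p ++ u).length = u.length + k := by rw [List.length_append]; omega
  refine ⟨(p ++ u).drop u.length, q, by rw [List.length_drop]; omega, hq,
    IsFreeWord.right_of_append (u := (p ++ u).take u.length) ?_⟩
  rw [← List.append_assoc, ← List.append_assoc, List.take_append_drop]
  simpa only [List.append_assoc] using hf

/-- Compactness: a word with arbitrarily long two-sided free extensions is in the language. -/
lemma mem_language_of_forall_isExtendable {d : ℕ} [NeZero d] {v : List (Fin d)}
    (h : ∀ k, IsExtendable β k v) : v ∈ language (betaFree d β) := by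
  choose p q hp hq hf using h
  let x : ℕ → ℤ → Fin d := fun k t => ((p k ++ v ++ q k)[(t + k).toNat]?).getD 0
  obtain ⟨y, hy⟩ := exists_clusterPt_of_compactSpace (map x atTop)
  have hfreq : ∀ (F : Finset ℤ) (N : ℕ), ∃ k ≥ N, ∀ t ∈ F, x k t = y t := by
    intro F N
    have hnhds : {z : ℤ → Fin d | ∀ t ∈ F, z t = y t} ∈ nhds y :=
      set_pi_mem_nhds F.finite_toSet (s := fun t => {y t}) fun t _ =>
        (isOpen_discrete _).mem_nhds rfl
    exact frequently_atTop.1 ((mapClusterPt_iff_frequently.1 hy) _ hnhds) N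
  refine ⟨y, fun w hw ℓ hℓ => ?_, 0, fun t ht => ?_⟩
  · obtain ⟨i, hi⟩ := hw
    obtain ⟨h1, h2, h3⟩ := hℓ
    obtain ⟨k, hk, hxy⟩ := hfreq (Finset.Ico i (i + w.length)) (i.natAbs + w.length)
    have hlen : (p k ++ v ++ q k).length = k + v.length + k := by
      simp only [List.length_append, hp, hq]
    obtain ⟨a, ha⟩ : ∃ a : ℕ, (a : ℤ) = i + k := ⟨(i + k).toNat, by omega⟩
    have hval : ∀ t (ht : t < w.length), (p k ++ v ++ q k)[a + t]? = some w[t] := by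
      intro t ht
      rw [← hi t ht, ← hxy (i + t) (by simp; omega)]
      simp only [x]
      rw [show (i + t + k).toNat = a + t by omega, List.getElem?_eq_getElem (by omega)]
      rfl
    have := hf k a (a + w.length) ℓ h1 (by omega) (by omega) fun t ht1 ht2 => by
      obtain ⟨s, rfl⟩ := Nat.exists_eq_add_of_le ht1
      rw [add_assoc, hval s (by omega), hval (s + ℓ) (by omega), h3 s (by omega)]
    push_cast at this
    linarith
  · obtain ⟨k, -, hxy⟩ := hfreq {(t : ℤ)} 0
    rw [zero_add, ← hxy t (by simp)]
    simp only [x]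
    rw [show ((t : ℤ) + k).toNat = k + t by omega, List.append_assoc,
      List.getElem?_append_right (by rw [hp]; omega), List.getElem?_append_left (by rw [hp]; omega),
      hp, Nat.add_sub_cancel_left, List.getElem?_eq_getElem ht]
    rfl

end FreeWord

/-- The binary words of length `n`. -/
noncomputable def binaryWords (n : ℕ) : Finset (List (Fin 2)) :=
  (List.finite_length_eq (Fin 2) n).toFinset

lemma mem_binaryWords {n : ℕ} {w : List (Fin 2)} : w ∈ binaryWords n ↔ w.length = n := by
  simp [binaryWords]

open Classical in
/-- The free binary words of length `n`. -/
noncomputable def freeWords (β : ℝ) (n : ℕ) : Finset (List (Fin 2)) :=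
  (binaryWords n).filter (IsFreeWord β)

lemma mem_freeWords {β : ℝ} {n : ℕ} {w : List (Fin 2)} :
    w ∈ freeWords β n ↔ w.length = n ∧ IsFreeWord β w := by
  simp [freeWords, mem_binaryWords]

open Classical in
/-- Free words of length `n` ending with a sixth power of a word of length `ℓ`. -/
noncomputable def suffixSixth (β : ℝ) (n ℓ : ℕ) : Finset (List (Fin 2)) :=
  (freeWords β n).filter fun u =>
    6 * ℓ ≤ n ∧ ∀ t, n - 6 * ℓ ≤ t → t + ℓ < n → u[t]? = u[t + ℓ]?

open Classical in
/-- Free words of length `n` beginning with a sixth power of a word of length `ℓ`. -/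
noncomputable def prefixSixth (β : ℝ) (n ℓ : ℕ) : Finset (List (Fin 2)) :=
  (freeWords β n).filter fun u => 6 * ℓ ≤ n ∧ ∀ t, t + ℓ < 6 * ℓ → u[t]? = u[t + ℓ]?

section Counting

variable {β : ℝ} {n ℓ : ℕ}

lemma card_suffixSixth_le (hℓ : 1 ≤ ℓ) :
    (suffixSixth β n ℓ).card ≤ if 6 * ℓ ≤ n then (freeWords β (n - 5 * ℓ)).card else 0 := by
  split_ifs with h
  · refine Finset.card_le_card_of_injOn (fun u => u.take (n - 5 * ℓ)) ?_ ?_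
    · intro u hu
      simp only [suffixSixth, Finset.coe_filter, mem_freeWords, mem_ofPred_eq] at hu
      obtain ⟨⟨hlen, hf⟩, -⟩ := hu
      rw [← List.take_append_drop (n - 5 * ℓ) u] at hf
      exact mem_freeWords.2 ⟨by rw [List.length_take]; omega, hf.left_of_append⟩
    · intro u hu v hv huv
      simp only [suffixSixth, Finset.coe_filter, mem_freeWords, mem_ofPred_eq] at hu hv
      exact eq_of_take_eq_of_period hℓ (by omega) hu.1.1 hv.1.1
        (fun t h1 h2 => hu.2.2 t (by omega) h2) (fun t h1 h2 => hv.2.2 t (by omega) h2) huv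
  · simp [suffixSixth, h]

lemma card_prefixSixth_le (hℓ : 1 ≤ ℓ) :
    (prefixSixth β n ℓ).card ≤ if 6 * ℓ ≤ n then (freeWords β (n - 5 * ℓ)).card else 0 := by
  split_ifs with h
  · refine Finset.card_le_card_of_injOn (fun u => u.drop (5 * ℓ)) ?_ ?_
    · intro u hu
      simp only [prefixSixth, Finset.coe_filter, mem_freeWords, mem_ofPred_eq] at hu
      obtain ⟨⟨hlen, hf⟩, -⟩ := hu
      rw [← List.take_append_drop (5 * ℓ) u] at hf
      exact mem_freeWords.2 ⟨by rw [List.length_drop]; omega, hf.right_of_append⟩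
    · intro u hu v hv huv
      simp only [prefixSixth, Finset.coe_filter, mem_freeWords, mem_ofPred_eq] at hu hv
      exact eq_of_drop_eq_of_period hℓ (fun t h1 => hu.2.2 t (by omega)) hu.1.1
        (fun t h1 => hv.2.2 t (by omega)) hv.1.1 huv
  · simp [prefixSixth, h]

/-- Upper bound for the number of free words of length `n` ending with a sixth power. -/
noncomputable def sixthBound (β : ℝ) (n : ℕ) : ℕ :=
  ∑ ℓ ∈ Finset.Icc 1 n, if 6 * ℓ ≤ n then (freeWords β (n - 5 * ℓ)).card else 0

lemma card_mul_card_le (hβ : 12 < β) (n m : ℕ) :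
    (freeWords β n).card * (freeWords β m).card ≤ (freeWords β (n + m)).card +
      (sixthBound β n * (freeWords β m).card + (freeWords β n).card * sixthBound β m) := by
  classical
  have hsub : freeWords β n ×ˢ freeWords β m ⊆
      (freeWords β n ×ˢ freeWords β m).filter (fun z => IsFreeWord β (z.1 ++ z.2)) ∪
      (((Finset.Icc 1 n).biUnion (suffixSixth β n)) ×ˢ freeWords β m ∪
        freeWords β n ×ˢ ((Finset.Icc 1 m).biUnion (prefixSixth β m))) := by
    rintro ⟨u, v⟩ huv
    obtain ⟨hu, hv⟩ := Finset.mem_product.1 huv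
    dsimp only at hu hv
    by_cases hf : IsFreeWord β (u ++ v)
    · exact Finset.mem_union_left _ (Finset.mem_filter.2 ⟨huv, hf⟩)
    refine Finset.mem_union_right _ (Finset.mem_union.2 ?_)
    obtain ⟨hu1, hu2⟩ := mem_freeWords.1 hu
    obtain ⟨hv1, hv2⟩ := mem_freeWords.1 hv
    rcases exists_sixth_power_of_not_isFreeWord_append hβ hu2 hv2 hf with
      ⟨ℓ, h1, h2, h3⟩ | ⟨ℓ, h1, h2, h3⟩
    · left
      rw [hu1] at h2 h3
      exact Finset.mem_product.2 ⟨Finset.mem_biUnion.2 ⟨ℓ, Finset.mem_Icc.2 ⟨h1, by omega⟩,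
        Finset.mem_filter.2 ⟨hu, h2, h3⟩⟩, hv⟩
    · right
      rw [hv1] at h2
      exact Finset.mem_product.2 ⟨hu, Finset.mem_biUnion.2 ⟨ℓ, Finset.mem_Icc.2 ⟨h1, by omega⟩,
        Finset.mem_filter.2 ⟨hv, h2, h3⟩⟩⟩
  have hgood : ((freeWords β n ×ˢ freeWords β m).filter
      (fun z => IsFreeWord β (z.1 ++ z.2))).card ≤ (freeWords β (n + m)).card := by
    refine Finset.card_le_card_of_injOn (fun z => z.1 ++ z.2) ?_ ?_
    · rintro ⟨u, v⟩ h
      simp only [Finset.coe_filter, Finset.mem_product, mem_freeWords, mem_ofPred_eq] at h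
      exact mem_freeWords.2 ⟨by simp [h.1.1.1, h.1.2.1], h.2⟩
    · rintro ⟨u, v⟩ h ⟨u', v'⟩ h' e
      simp only [Finset.coe_filter, Finset.mem_product, mem_freeWords, mem_ofPred_eq] at h h'
      obtain ⟨rfl, rfl⟩ := List.append_inj e (h.1.1.1.trans h'.1.1.1.symm)
      rfl
  have hS : ((Finset.Icc 1 n).biUnion (suffixSixth β n)).card ≤ sixthBound β n :=
    Finset.card_biUnion_le.trans (Finset.sum_le_sum fun ℓ h =>
      card_suffixSixth_le (Finset.mem_Icc.1 h).1)
  have hP : ((Finset.Icc 1 m).biUnion (prefixSixth β m)).card ≤ sixthBound β m :=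
    Finset.card_biUnion_le.trans (Finset.sum_le_sum fun ℓ h =>
      card_prefixSixth_le (Finset.mem_Icc.1 h).1)
  rw [← Finset.card_product]
  refine (Finset.card_le_card hsub).trans ((Finset.card_union_le _ _).trans
    (add_le_add hgood ((Finset.card_union_le _ _).trans ?_)))
  rw [Finset.card_product, Finset.card_product]
  gcongr

lemma sixthBound_le_of_growth
    (h : ∀ k < n, (3 / 2 : ℝ) * (freeWords β k).card ≤ (freeWords β (k + 1)).card) :
    (sixthBound β n : ℝ) ≤ (freeWords β n).card / 4 := by
  have hpow : ∀ k ≤ n, (3 / 2 : ℝ) ^ k * (freeWords β (n - k)).card ≤ (freeWords β n).card := by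
    intro k
    induction k with
    | zero => simp
    | succ k ih =>
      intro hk
      have h1 := h (n - (k + 1)) (by omega)
      rw [show n - (k + 1) + 1 = n - k by omega] at h1
      calc _ = (3 / 2 : ℝ) ^ k * (3 / 2 * (freeWords β (n - (k + 1))).card) := by ring
        _ ≤ (3 / 2 : ℝ) ^ k * (freeWords β (n - k)).card := by gcongr
        _ ≤ _ := ih (by omega)
  have hterm : ∀ ℓ ∈ Finset.Icc 1 n,
      ((if 6 * ℓ ≤ n then (freeWords β (n - 5 * ℓ)).card else 0 : ℕ) : ℝ) ≤
        (1 / 5 : ℝ) ^ ℓ * (freeWords β n).card := by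
    intro ℓ _
    split_ifs with h6
    · have h1 := hpow (5 * ℓ) (by omega)
      have h2 : (5 : ℝ) ^ ℓ ≤ (3 / 2 : ℝ) ^ (5 * ℓ) := by
        rw [pow_mul]; gcongr; norm_num
      rw [one_div, inv_pow, ← div_eq_inv_mul, le_div_iff₀' (by positivity)]
      exact (mul_le_mul_of_nonneg_right h2 (Nat.cast_nonneg _)).trans h1
    · simp only [Nat.cast_zero]; positivity
  have hgeom : ∀ m : ℕ, ∑ ℓ ∈ Finset.Icc 1 m, (1 / 5 : ℝ) ^ ℓ = (1 - (1 / 5) ^ m) / 4 := by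
    intro m
    induction m with
    | zero => simp
    | succ m ih => rw [Finset.sum_Icc_succ_top (by omega), ih]; ring
  rw [sixthBound, Nat.cast_sum]
  refine (Finset.sum_le_sum hterm).trans ?_
  rw [← Finset.sum_mul, hgeom]
  have : (0 : ℝ) ≤ (1 / 5) ^ n * (freeWords β n).card := by positivity
  linarith

lemma two_le_card_freeWords_one (hβ : 12 < β) : 2 ≤ (freeWords β 1).card := by
  have hsub : ({[0], [1]} : Finset (List (Fin 2))) ⊆ freeWords β 1 := by
    intro w hw
    have hlen : w.length = 1 := by
      simp only [Finset.mem_insert, Finset.mem_singleton] at hw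
      rcases hw with rfl | rfl <;> rfl
    refine mem_freeWords.2 ⟨hlen, fun i j ℓ hℓ hij hj _ => ?_⟩
    obtain ⟨rfl, rfl, rfl⟩ : i = 0 ∧ j = 1 ∧ ℓ = 1 := by omega
    push_cast
    linarith
  exact (Finset.card_le_card hsub).trans' (by decide)

lemma card_freeWords_growth (hβ : 12 < β) (n : ℕ) :
    (3 / 2 : ℝ) * (freeWords β n).card ≤ (freeWords β (n + 1)).card := by
  induction n using Nat.strong_induction_on with
  | _ n ih =>
    have h1 := sixthBound_le_of_growth ih
    have h2 : sixthBound β 1 = 0 := by simp [sixthBound]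
    have h3 := card_mul_card_le hβ n 1
    rw [h2, mul_zero, add_zero] at h3
    have h3' : ((freeWords β n).card : ℝ) * (freeWords β 1).card ≤
        (freeWords β (n + 1)).card + sixthBound β n * (freeWords β 1).card := by exact_mod_cast h3
    have h4 : (2 : ℝ) ≤ (freeWords β 1).card := by exact_mod_cast two_le_card_freeWords_one hβ
    have h5 : (0 : ℝ) ≤ (freeWords β n).card := Nat.cast_nonneg _
    nlinarith

lemma card_freeWords_mono (hβ : 12 < β) : Monotone fun n => (freeWords β n).card :=
  monotone_nat_of_le_succ fun n => by
    have h1 := card_freeWords_growth hβ n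
    have h2 : (0 : ℝ) ≤ (freeWords β n).card := Nat.cast_nonneg _
    have : ((freeWords β n).card : ℝ) ≤ (freeWords β (n + 1)).card := by linarith
    exact_mod_cast this

lemma card_freeWords_pos (hβ : 12 < β) (n : ℕ) : 0 < (freeWords β n).card := by
  refine lt_of_lt_of_le (Finset.card_pos.2 ⟨[], ?_⟩) (card_freeWords_mono hβ (Nat.zero_le n))
  exact mem_freeWords.2 ⟨rfl, fun i j ℓ hℓ hij hj _ => absurd hj (by simp; omega)⟩

lemma card_mul_card_le_two_mul (hβ : 12 < β) (n m : ℕ) :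
    ((freeWords β n).card : ℝ) * (freeWords β m).card ≤ 2 * (freeWords β (n + m)).card := by
  have h1 := sixthBound_le_of_growth (n := n) fun k _ => card_freeWords_growth hβ k
  have h2 := sixthBound_le_of_growth (n := m) fun k _ => card_freeWords_growth hβ k
  have h3 : ((freeWords β n).card : ℝ) * (freeWords β m).card ≤ (freeWords β (n + m)).card +
      (sixthBound β n * (freeWords β m).card + (freeWords β n).card * sixthBound β m) := by
    exact_mod_cast card_mul_card_le hβ n m
  have h4 := mul_le_mul_of_nonneg_right h1 (Nat.cast_nonneg (α := ℝ) (freeWords β m).card)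
  have h5 := mul_le_mul_of_nonneg_left h2 (Nat.cast_nonneg (α := ℝ) (freeWords β n).card)
  linarith

lemma half_card_pow_le (hβ : 12 < β) (n k : ℕ) :
    ((freeWords β n).card / 2 : ℝ) ^ k ≤ (freeWords β (n * k)).card := by
  induction k with
  | zero => simpa using card_freeWords_pos hβ 0
  | succ k ih =>
    have := card_mul_card_le_two_mul hβ (n * k) n
    calc _ = ((freeWords β n).card / 2 : ℝ) ^ k * ((freeWords β n).card / 2 : ℝ) := pow_succ _ _
      _ ≤ (freeWords β (n * k)).card * ((freeWords β n).card / 2 : ℝ) := by gcongr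
      _ ≤ _ := by rw [mul_add_one]; linarith

open Classical in
/-- Words of length `n` with free extensions by `k` letters on both sides. -/
noncomputable def extendableWords (β : ℝ) (k n : ℕ) : Finset (List (Fin 2)) :=
  (binaryWords n).filter (IsExtendable β k)

lemma mem_extendableWords {k : ℕ} {w : List (Fin 2)} :
    w ∈ extendableWords β k n ↔ w.length = n ∧ IsExtendable β k w := by
  simp [extendableWords, mem_binaryWords]

lemma card_extendableWords_add_le (k n m : ℕ) : (extendableWords β k (n + m)).card ≤
    (extendableWords β k n).card * (extendableWords β k m).card := by
  classical
  rw [← Finset.card_product]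
  refine (Finset.card_le_card (t := (extendableWords β k n ×ˢ extendableWords β k m).image
    fun z => z.1 ++ z.2) fun w hw => ?_).trans Finset.card_image_le
  obtain ⟨hlen, he⟩ := mem_extendableWords.1 hw
  rw [← List.take_append_drop n w] at he
  refine Finset.mem_image.2 ⟨(w.take n, w.drop n), Finset.mem_product.2
    ⟨mem_extendableWords.2 ⟨by rw [List.length_take]; omega, he.left_of_append⟩,
      mem_extendableWords.2 ⟨by rw [List.length_drop]; omega, he.right_of_append⟩⟩,
    List.take_append_drop n w⟩

lemma card_extendableWords_mul_le (k n r : ℕ) : (extendableWords β k (n * r)).card ≤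
    (binaryWords 0).card * (extendableWords β k n).card ^ r := by
  classical
  induction r with
  | zero =>
    rw [mul_zero, pow_zero, mul_one]
    exact Finset.card_le_card (Finset.filter_subset _ _)
  | succ r ih =>
    rw [mul_add_one, pow_succ, ← mul_assoc]
    exact (card_extendableWords_add_le k (n * r) n).trans (by gcongr)

lemma card_freeWords_le_extendable (k n : ℕ) : (freeWords β (k + n + k)).card ≤
    (binaryWords k).card * ((extendableWords β k n).card * (binaryWords k).card) := by
  classical
  rw [← Finset.card_product, ← Finset.card_product]
  refine (Finset.card_le_card (t := (binaryWords k ×ˢ extendableWords β k n ×ˢ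
    binaryWords k).image fun z => z.1 ++ z.2.1 ++ z.2.2) fun w hw => ?_).trans
    Finset.card_image_le
  obtain ⟨hlen, hf⟩ := mem_freeWords.1 hw
  have hw : w.take k ++ (w.drop k).take n ++ (w.drop k).drop n = w := by
    rw [List.append_assoc, List.take_append_drop, List.take_append_drop]
  have h1 : (w.take k).length = k := by rw [List.length_take]; omega
  have h2 : ((w.drop k).take n).length = n := by rw [List.length_take, List.length_drop]; omega
  have h3 : ((w.drop k).drop n).length = k := by rw [List.length_drop, List.length_drop]; omega
  exact Finset.mem_image.2 ⟨(w.take k, (w.drop k).take n, (w.drop k).drop n),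
    Finset.mem_product.2 ⟨mem_binaryWords.2 h1, Finset.mem_product.2
      ⟨mem_extendableWords.2 ⟨h2, _, _, h1, h3, by rwa [hw]⟩, mem_binaryWords.2 h3⟩⟩, hw⟩

lemma finite_langN (X : Set (ℤ → Fin 2)) (n : ℕ) : (langN X n).Finite :=
  (List.finite_length_eq (Fin 2) n).subset fun _ h => h.2

lemma ncard_langN_le (β : ℝ) (n : ℕ) :
    (langN (betaFree 2 β) n).ncard ≤ (freeWords β n).card := by
  rw [← Set.ncard_coe_finset]
  exact Set.ncard_le_ncard
    (fun w h => mem_freeWords.2 ⟨h.2, isFreeWord_of_mem_language h.1⟩) (Finset.finite_toSet _)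

lemma exists_card_extendableWords_le (β : ℝ) (n : ℕ) :
    ∃ k, (extendableWords β k n).card ≤ (langN (betaFree 2 β) n).ncard := by
  classical
  have h : ∀ w : List (Fin 2), ∃ k, IsExtendable β k w → w ∈ language (betaFree 2 β) := by
    intro w
    by_cases hw : ∀ k, IsExtendable β k w
    · exact ⟨0, fun _ => mem_language_of_forall_isExtendable hw⟩
    · obtain ⟨k, hk⟩ := not_forall.1 hw
      exact ⟨k, fun h => absurd h hk⟩
  choose f hf using h
  refine ⟨(binaryWords n).sup f, ?_⟩
  rw [← Set.ncard_coe_finset]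
  refine Set.ncard_le_ncard (fun w hw => ?_) (finite_langN _ n)
  obtain ⟨h1, h2⟩ := mem_extendableWords.1 hw
  exact ⟨hf w (h2.mono (Finset.le_sup (mem_binaryWords.2 h1))), h1⟩

lemma exists_card_freeWords_mul_le (hβ : 12 < β) (n : ℕ) :
    ∃ C : ℕ, ∀ r, (freeWords β (n * r)).card ≤ C * (langN (betaFree 2 β) n).ncard ^ r := by
  obtain ⟨k, hk⟩ := exists_card_extendableWords_le β n
  refine ⟨(binaryWords k).card * ((binaryWords 0).card * (binaryWords k).card), fun r => ?_⟩
  calc (freeWords β (n * r)).card ≤ (freeWords β (k + n * r + k)).card :=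
        card_freeWords_mono hβ (by omega)
    _ ≤ (binaryWords k).card * ((extendableWords β k (n * r)).card * (binaryWords k).card) :=
        card_freeWords_le_extendable k (n * r)
    _ ≤ (binaryWords k).card * ((binaryWords 0).card * (langN (betaFree 2 β) n).ncard ^ r *
          (binaryWords k).card) := by
        gcongr
        exact (card_extendableWords_mul_le k n r).trans (by gcongr)
    _ = _ := by ring

lemma ncard_langN_pos (hβ : 12 < β) (n : ℕ) : 0 < (langN (betaFree 2 β) n).ncard := by
  obtain ⟨C, hC⟩ := exists_card_freeWords_mul_le hβ n
  have h := (card_freeWords_pos hβ (n * 1)).trans_le (hC 1)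
  rw [pow_one] at h
  exact Nat.pos_of_mul_pos_left h

end Counting

lemma le_of_forall_pow_le_mul_pow {a b C : ℝ} (hb : 0 < b)
    (h : ∀ k : ℕ, a ^ k ≤ C * b ^ k) : a ≤ b := by
  by_contra! hc
  obtain ⟨k, hk⟩ := pow_unbounded_of_one_lt C ((one_lt_div hb).2 hc)
  rw [div_pow, lt_div_iff₀ (by positivity)] at hk
  exact absurd (h k) (not_le.2 hk)

lemma mul_log_sub_log_two_le {β : ℝ} (hβ : 12 < β) (n m : ℕ) :
    (m : ℝ) * (log (langN (betaFree 2 β) n).ncard - log 2) ≤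
      n * log (langN (betaFree 2 β) m).ncard := by
  have hn : (0 : ℝ) < (langN (betaFree 2 β) n).ncard := by exact_mod_cast ncard_langN_pos hβ n
  have hm : (0 : ℝ) < (langN (betaFree 2 β) m).ncard := by exact_mod_cast ncard_langN_pos hβ m
  obtain ⟨C, hC⟩ := exists_card_freeWords_mul_le hβ m
  have key : ((langN (betaFree 2 β) n).ncard / 2 : ℝ) ^ m ≤
      ((langN (betaFree 2 β) m).ncard : ℝ) ^ n := by
    refine le_of_forall_pow_le_mul_pow (C := C) (by positivity) fun k => ?_
    have hle : ((langN (betaFree 2 β) n).ncard : ℝ) ≤ (freeWords β n).card := by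
      exact_mod_cast ncard_langN_le β n
    calc _ ≤ (((freeWords β n).card / 2 : ℝ) ^ m) ^ k := by gcongr
      _ = ((freeWords β n).card / 2 : ℝ) ^ (m * k) := (pow_mul _ _ _).symm
      _ ≤ (freeWords β (n * (m * k))).card := half_card_pow_le hβ n (m * k)
      _ = (freeWords β (m * (n * k))).card := by rw [mul_left_comm]
      _ ≤ C * ((langN (betaFree 2 β) m).ncard : ℝ) ^ (n * k) := by exact_mod_cast hC (n * k)
      _ = _ := by rw [pow_mul]
  have := log_le_log (by positivity) key
  rwa [log_pow, log_pow, log_div hn.ne' two_ne_zero] at this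

/-- Counting bounds for the binary `β`-free shift, `β > 12`. -/
theorem card_bounds_beta_free_binary (β : ℝ) (hβ : 12 < β) (h : ℝ)
    (hEnt : Tendsto (fun n : ℕ => Real.log ((langN (betaFree 2 β) n).ncard) / n)
      atTop (nhds h)) :
    ∀ n : ℕ, 1 ≤ n →
      Real.exp (n * h) ≤ ((langN (betaFree 2 β) n).ncard : ℝ) ∧
      ((langN (betaFree 2 β) n).ncard : ℝ) ≤ 2.892 * Real.exp ((n + 2) * h) := by
  intro n hn
  have hn0 : (0 : ℝ) < n := by exact_mod_cast hn
  have hpos : (0 : ℝ) < (langN (betaFree 2 β) n).ncard := by exact_mod_cast ncard_langN_pos hβ n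
  have h0 : 0 ≤ h := ge_of_tendsto' hEnt fun m =>
    div_nonneg (log_natCast_nonneg _) (Nat.cast_nonneg m)
  have hlower : h ≤ log (langN (betaFree 2 β) n).ncard / n := by
    have hlim : Tendsto (fun m : ℕ => log ((langN (betaFree 2 β) m).ncard) / m - log 2 / m)
        atTop (nhds (h - 0)) := hEnt.sub (tendsto_const_div_atTop_nhds_zero_nat _)
    rw [sub_zero] at hlim
    refine le_of_tendsto hlim ((eventually_gt_atTop 0).mono fun m hm => ?_)
    have hm0 : (0 : ℝ) < m := by exact_mod_cast hm
    rw [← sub_div, div_le_div_iff₀ hm0 hn0]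
    linarith [mul_log_sub_log_two_le hβ m n]
  have hupper : (log (langN (betaFree 2 β) n).ncard - log 2) / n ≤ h := by
    refine ge_of_tendsto hEnt ((eventually_gt_atTop 0).mono fun m hm => ?_)
    have hm0 : (0 : ℝ) < m := by exact_mod_cast hm
    rw [div_le_div_iff₀ hn0 hm0]
    linarith [mul_log_sub_log_two_le hβ n m]
  constructor
  · rw [← le_log_iff_exp_le hpos]
    rwa [le_div_iff₀ hn0, mul_comm] at hlower
  · rw [div_le_iff₀ hn0] at hupper
    calc ((langN (betaFree 2 β) n).ncard : ℝ)
        = exp (log (langN (betaFree 2 β) n).ncard) := (exp_log hpos).symm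
      _ ≤ exp (log 2 + (n + 2) * h) := exp_le_exp.2 (by linarith)
      _ = 2 * exp ((n + 2) * h) := by rw [exp_add, exp_log two_pos]
      _ ≤ 2.892 * exp ((n + 2) * h) := by gcongr; norm_num
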